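/- For every non-negative integer n, Q_11(11n + 6) ≡ 0 (mod 11), where Q_11(m) is the total number of parts equal to 11 among all partitions of m. -/

import Mathlib

/-- Number of partitions of `n`. -/
def P (n : ℕ) : ℕ := Fintype.card (Nat.Partition n)

/-- Partition function extended to `ℤ`, zero for negative arguments. -/
def PZ (z : ℤ) : ℕ := if z < 0 then 0 else P z.toNat

/-- Total number of occurrences of the part `k` over all partitions of `n`. -/
def Q (k n : ℕ) : ℕ := ∑ p : Nat.Partition n, Multiset.count k p.parts

/-- `Q` extended to `ℤ`, zero for non-positive arguments. -/
def QZ (k : ℕ) (z : ℤ) : ℕ := if z ≤ 0 then 0 else Q k z.toNat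

/-- Sum over all partitions of `n` of the number of distinct part-sizes. -/
def S (n : ℕ) : ℕ := ∑ p : Nat.Partition n, p.parts.toFinset.card

/-- Number of pairs `(λ, m)` with `λ` a partition of `n` and `m` a part-size
occurring at least `k` times in `λ`. -/
def V (k n : ℕ) : ℕ :=
  ∑ p : Nat.Partition n, (p.parts.toFinset.filter (fun m => k ≤ p.parts.count m)).card

namespace Ram
open PowerSeries Finset
open scoped PowerSeries.WithPiTopology

abbrev F := ZMod 11
instance : Fact (Nat.Prime 11) := ⟨by norm_num⟩

noncomputable def E : F⟦X⟧ := pentagonalSeries F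
noncomputable def PG : F⟦X⟧ := PowerSeries.mk fun n => (P n : F)
noncomputable def qp (n : ℕ) : F⟦X⟧ := ∏ i ∈ range n, (1 - X ^ (i + 1))

theorem PG_mul_E : PG * E = 1 := by
  let : TopologicalSpace F := ⊥
  have : DiscreteTopology F := ⟨rfl⟩
  have h1 := Nat.Partition.hasProd_powerSeriesMk_card_restricted F (fun _ => True)
  have h2 := PowerSeries.WithPiTopology.hasProd_one_sub_X_pow F
  have h3 := h1.mul h2
  have h4 : (PowerSeries.mk fun n ↦ (#(Nat.Partition.restricted n (fun _ => True)) : F)) = PG := by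
    ext n
    simp [PG, Nat.Partition.restricted, P]
  rw [h4] at h3
  have h5 : (fun i : ℕ => (if True then ∑' j : ℕ, (X : F⟦X⟧) ^ ((i + 1) * j) else 1) * (1 - X ^ (i + 1)))
      = fun _ => 1 := by
    funext i
    simp only [if_true, pow_mul]
    exact PowerSeries.WithPiTopology.tsum_pow_mul_one_sub_of_constantCoeff_eq_zero (by simp)
  rw [h5] at h3
  exact h3.unique hasProd_one

theorem qp_dvd (n k : ℕ) : (X : F⟦X⟧) ^ (n + 1) ∣ qp (n + k) - qp n := by
  induction k with
  | zero => simp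
  | succ k ih =>
    have : qp (n + (k + 1)) - qp n = (qp (n + k) - qp n) - X ^ (n + 1) * (X ^ k * qp (n + k)) := by
      rw [← add_assoc, qp, prod_range_succ, ← qp]
      ring
    rw [this]
    exact dvd_sub ih (dvd_mul_right _ _)

theorem E_dvd (n : ℕ) : (X : F⟦X⟧) ^ (n + 1) ∣ E - qp n := by
  rw [X_pow_dvd_iff]
  intro m hm
  obtain ⟨s, hs⟩ := Filter.eventually_atTop.1 (coeff_prod_one_sub_X_pow_eventually_eq F m)
  obtain ⟨K, hK⟩ := s.exists_nat_subset_range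
  have h1 := hs (range (n + K)) (hK.trans (range_subset_range.2 (by omega)))
  have h2 := X_pow_dvd_iff.1 (qp_dvd n K) m hm
  rw [map_sub] at h2 ⊢
  rw [E, ← h1]
  exact h2

/-- Gaussian binomial coefficients. -/
noncomputable def gb : ℕ → ℕ → F⟦X⟧
  | _, 0 => 1
  | 0, _ + 1 => 0
  | N + 1, j + 1 => gb N (j + 1) + X ^ (N - j) * gb N j

theorem gb_zero_right (N : ℕ) : gb N 0 = 1 := by cases N <;> simp [gb]

theorem gb_eq_zero (N j : ℕ) (h : N < j) : gb N j = 0 := by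
  induction N generalizing j with
  | zero => cases j with
    | zero => omega
    | succ j => simp [gb]
  | succ N ih => cases j with
    | zero => omega
    | succ j => simp [gb, ih (j + 1) (by omega), ih j (by omega)]

theorem qp_succ (n : ℕ) : qp (n + 1) = qp n * (1 - X ^ (n + 1)) := by
  rw [qp, prod_range_succ, ← qp]

theorem gb_mul (N : ℕ) : ∀ j k, j + k = N → gb N j * qp j * qp k = qp N := by
  induction N with
  | zero =>
    intro j k h
    obtain rfl : j = 0 := by omega
    obtain rfl : k = 0 := by omega
    simp [gb, qp]
  | succ N ih =>
    intro j k h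
    cases j with
    | zero =>
      obtain rfl : k = N + 1 := by omega
      simp [gb, qp]
    | succ j =>
      cases k with
      | zero =>
        obtain rfl : j = N := by omega
        have := ih j 0 (by omega)
        simp only [gb, gb_eq_zero j (j + 1) (by omega), qp_succ, Nat.sub_self, pow_zero]
        linear_combination (1 - X ^ (j + 1)) * this
      | succ k =>
        obtain rfl : N = j + 1 + k := by omega
        have h1 := ih (j + 1) k (by omega)
        have h2 := ih j (k + 1) (by omega)
        have e : j + 1 + k - j = k + 1 := by omega
        simp only [gb, e]
        rw [qp_succ (j + 1 + k)]
        rw [qp_succ k] at h2 ⊢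
        rw [qp_succ j] at h1 ⊢
        linear_combination (1 - X ^ (k + 1)) * h1 + X ^ (k + 1) * (1 - X ^ (j + 1)) * h2

theorem gb_E (N j k : ℕ) (h : j + k = N) (r : ℕ) (hj : r ≤ j + 1) (hk : r ≤ k + 1) :
    (X : F⟦X⟧) ^ r ∣ gb N j * E - 1 := by
  have h1 := (pow_dvd_pow (X : F⟦X⟧) hj).trans (E_dvd j)
  have h2 := (pow_dvd_pow (X : F⟦X⟧) hk).trans (E_dvd k)
  have h3 := (pow_dvd_pow (X : F⟦X⟧) (show r ≤ N + 1 by omega)).trans (E_dvd N)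
  have h4 := gb_mul N j k h
  have : gb N j * E - 1 = PG * (gb N j * E * (E - qp k) + gb N j * qp k * (E - qp j) - (E - qp N)) := by
    linear_combination (- (gb N j * E) + 1) * PG_mul_E + PG * h4
  rw [this]
  exact ((h2.mul_left _).add (h1.mul_left _) |>.sub h3 |>.mul_left _)

theorem prodform' {R : Type*} [CommRing R] (q : R) (g : ℕ → ℕ → R) (h0 : ∀ N, g N 0 = 1)
    (hz : ∀ N, g N (N + 1) = 0) (hs : ∀ N j, g (N + 1) (j + 1) = g N (j + 1) + q ^ (N - j) * g N j)
    (y : R) (N : ℕ) : ∏ i ∈ range N, (y - q ^ i) =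
    ∑ j ∈ range (N + 1), (-1) ^ j * q ^ (j.choose 2) * g N j * y ^ (N - j) := by
  induction N with
  | zero => simp [h0]
  | succ N ih =>
    rw [prod_range_succ, ih, mul_sub, sum_range_succ' _ (N + 1)]
    have h1 : (∑ j ∈ range (N + 1), (-1) ^ j * q ^ (j.choose 2) * g N j * y ^ (N - j)) * y
       = ∑ j ∈ range (N + 1), (-1) ^ (j+1) * q ^ ((j+1).choose 2) * g N (j+1) * y ^ (N - j) + y ^ (N + 1) := by
      rw [sum_range_succ', add_mul, sum_mul, sum_range_succ _ N, hz, h0]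
      simp only [mul_zero, zero_mul, add_zero]
      congr 1
      · refine sum_congr rfl fun j hj => ?_
        have : N - j = N - (j + 1) + 1 := by have := mem_range.1 hj; omega
        rw [this, pow_succ]; ring
      · simp [pow_succ]
    rw [h1]
    have h2 : ∀ j ∈ range (N + 1), (-1) ^ (j + 1) * q ^ (j + 1).choose 2 * g (N + 1) (j + 1) * y ^ (N + 1 - (j + 1)) =
       (-1) ^ (j+1) * q ^ ((j+1).choose 2) * g N (j+1) * y ^ (N - j)
       - (-1) ^ j * q ^ (j.choose 2) * g N j * y ^ (N - j) * q ^ N := by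
      intro j hj
      have hj := mem_range.1 hj
      have e : q ^ N = q ^ j * q ^ (N - j) := by
        rw [← pow_add]; congr 1; omega
      have e2 : (j + 1).choose 2 = j + j.choose 2 := by simp [Nat.choose_succ_succ']
      rw [hs, e, e2, Nat.add_sub_add_right]
      ring
    rw [sum_congr rfl h2, sum_sub_distrib, sum_mul, h0]
    simp
    ring

open Polynomial in
theorem prodform (N : ℕ) : ∏ i ∈ range N, ((Polynomial.X : (F⟦X⟧)[X]) - Polynomial.C (PowerSeries.X ^ i)) =
    ∑ j ∈ range (N + 1), Polynomial.C ((-1) ^ j * PowerSeries.X ^ (j.choose 2) * gb N j) * Polynomial.X ^ (N - j) := by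
  have := prodform' (Polynomial.C (PowerSeries.X : F⟦X⟧)) (fun N j => Polynomial.C (gb N j))
    (fun N => by simp [gb_zero_right]) (fun N => by simp [gb_eq_zero]) (fun N j => by simp [gb]) Polynomial.X N
  simpa using this

theorem prod1 (n : ℕ) : ∏ i ∈ range n, ((X : F⟦X⟧) ^ n - X ^ i) = (-1) ^ n * X ^ (n.choose 2) * qp n := by
  have : ∀ i ∈ range n, ((X : F⟦X⟧) ^ n - X ^ i) = (-1) * X ^ i * (1 - X ^ (n - 1 - i + 1)) := by
    intro i hi
    have := mem_range.1 hi
    have e : (X : F⟦X⟧) ^ n = X ^ i * X ^ (n - 1 - i + 1) := by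
      rw [← pow_add]; congr 1; omega
    rw [e]; ring
  rw [prod_congr rfl this, prod_mul_distrib, prod_mul_distrib, prod_pow_eq_pow_sum,
    prod_range_reflect (fun i => (1 - (X : F⟦X⟧) ^ (i + 1))), ← qp, Finset.sum_range_id, ← Nat.choose_two_right]
  simp

theorem prod2 (n : ℕ) : ∏ i ∈ range n, ((X : F⟦X⟧) ^ n - X ^ (n + 1 + i)) = X ^ (n * n) * qp n := by
  have : ∀ i ∈ range n, ((X : F⟦X⟧) ^ n - X ^ (n + 1 + i)) = X ^ n * (1 - X ^ (i + 1)) := by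
    intro i hi
    ring
  rw [prod_congr rfl this, prod_mul_distrib, ← qp]
  simp [pow_mul]

theorem finiteJacobi (n : ℕ) : (-1) ^ n * X ^ (n.choose 2 + n * n) * qp n ^ 2 =
    ∑ j ∈ range (2 * n + 2), ((2 * n + 1 - j : ℕ) : F⟦X⟧) * (-1) ^ j * X ^ (j.choose 2 + n * (2 * n + 1 - j - 1)) * gb (2 * n + 1) j := by
  have h := prodform (2 * n + 1)
  have h1 := congrArg (fun p => Polynomial.eval (X ^ n : F⟦X⟧) (Polynomial.derivative p)) h
  have e : 2 * n + 1 = n + 1 + n := by ring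
  rw [show range (2 * n + 1) = range (n + 1 + n) by rw [e], prod_range_add, prod_range_succ] at h1
  simp only [Polynomial.derivative_mul, Polynomial.derivative_sub, Polynomial.derivative_X, Polynomial.derivative_C,
    Polynomial.eval_add, Polynomial.eval_mul, Polynomial.eval_sub, Polynomial.eval_X, Polynomial.eval_C, Polynomial.eval_prod, sub_self, mul_zero, zero_mul, add_zero, zero_add, sub_zero, Polynomial.eval_one, mul_one, prod1, prod2, Polynomial.derivative_sum, Polynomial.eval_finsetSum, Polynomial.derivative_X_pow, Polynomial.eval_pow, Polynomial.eval_natCast] at h1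
  calc _ = _ := by ring
    _ = _ := h1
    _ = _ := by
      refine sum_congr rfl fun j _ => ?_
      rw [← pow_mul, pow_add]; ring

theorem jac_dvd (n : ℕ) : (X : F⟦X⟧) ^ (n.choose 2 + n * n + (n + 1)) ∣ (-1) ^ n * X ^ (n.choose 2 + n * n) * E ^ 3 -
    ∑ j ∈ range (2 * n + 2), ((2 * n + 1 - j : ℕ) : F⟦X⟧) * (-1) ^ j * X ^ (j.choose 2 + n * (2 * n + 1 - j - 1)) := by
  have h1 : (X : F⟦X⟧) ^ (n.choose 2 + n * n + (n + 1)) ∣ (-1) ^ n * X ^ (n.choose 2 + n * n) * E ^ 3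
     - ((-1) ^ n * X ^ (n.choose 2 + n * n) * qp n ^ 2) * E := by
    have : (-1) ^ n * X ^ (n.choose 2 + n * n) * E ^ 3 - ((-1) ^ n * X ^ (n.choose 2 + n * n) * qp n ^ 2) * E
      = X ^ (n.choose 2 + n * n) * (E - qp n) * ((-1) ^ n * E * (E + qp n)) := by ring
    rw [this, pow_add]
    exact (mul_dvd_mul_left _ (E_dvd n)).mul_right _
  have h2 : (X : F⟦X⟧) ^ (n.choose 2 + n * n + (n + 1)) ∣ ((-1) ^ n * X ^ (n.choose 2 + n * n) * qp n ^ 2) * E -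
    ∑ j ∈ range (2 * n + 2), ((2 * n + 1 - j : ℕ) : F⟦X⟧) * (-1) ^ j * X ^ (j.choose 2 + n * (2 * n + 1 - j - 1)) := by
    rw [finiteJacobi, sum_mul, ← sum_sub_distrib]
    refine dvd_sum fun j hj => ?_
    have hj := mem_range.1 hj
    by_cases hjn : j = 2 * n + 1
    · simp [hjn]
    have key : ∃ r, r ≤ j + 1 ∧ r ≤ 2 * n + 1 - j + 1 ∧ n.choose 2 + n * n + (n + 1) ≤ j.choose 2 + n * (2 * n + 1 - j - 1) + r := by
      rcases le_or_gt j n with h | h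
      · refine ⟨j + 1, le_rfl, by omega, ?_⟩
        obtain ⟨k, rfl⟩ := Nat.exists_eq_add_of_le h
        have e : 2 * (j + k) + 1 - j - 1 = j + 2 * k := by omega
        rw [e]
        have a1 : (j + k).choose 2 = j.choose 2 + j * k + k.choose 2 := by
          rw [Nat.add_choose_eq]; simp [Finset.Nat.antidiagonal_succ]; ring
        have a2 : k.choose 2 + k ≤ k * k := by
          rcases k with _ | k
          · simp
          · have := Nat.triangle_succ k
            rw [Nat.choose_two_right]
            have h3 : (k + 1) * (k + 1 - 1) / 2 * 2 ≤ (k+1) * (k + 1 - 1) := Nat.div_mul_le_self _ _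
            simp only [Nat.add_sub_cancel] at h3 ⊢
            nlinarith
        rw [a1]
        nlinarith
      · refine ⟨2 * n + 1 - j + 1, by omega, le_rfl, ?_⟩
        obtain ⟨k, rfl⟩ := Nat.exists_eq_add_of_le (show n + 1 ≤ j from h)
        obtain ⟨l, rfl⟩ := Nat.exists_eq_add_of_le (show k + 1 ≤ n by omega)
        have e : 2 * (k + 1 + l) + 1 - (k + 1 + l + 1 + k) = l + 1 := by omega
        rw [e]
        have a1 : (k + 1 + l + 1 + k).choose 2 = (k + 1 + l).choose 2 + (k + 1 + l) * (1 + k) + (1 + k).choose 2 := by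
          rw [add_assoc (k + 1 + l), Nat.add_choose_eq (k + 1 + l) (1 + k)]; simp [Finset.Nat.antidiagonal_succ]; ring
        rw [a1, Nat.add_sub_cancel]
        have a2 : (1 + k).choose 2 = k + k.choose 2 := by
          rw [add_comm 1 k]; simp [Nat.choose_succ_succ']
        rw [a2]
        nlinarith
    obtain ⟨r, hr1, hr2, hr3⟩ := key
    have := gb_E (2 * n + 1) j (2 * n + 1 - j) (by omega) r hr1 hr2
    have e : ((2 * n + 1 - j : ℕ) : F⟦X⟧) * (-1) ^ j * X ^ (j.choose 2 + n * (2 * n + 1 - j - 1)) * gb (2 * n + 1) j * E -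
      ((2 * n + 1 - j : ℕ) : F⟦X⟧) * (-1) ^ j * X ^ (j.choose 2 + n * (2 * n + 1 - j - 1)) =
      X ^ (j.choose 2 + n * (2 * n + 1 - j - 1)) * (gb (2 * n + 1) j * E - 1) * (((2 * n + 1 - j : ℕ) : F⟦X⟧) * (-1) ^ j) := by ring
    rw [e]
    refine (pow_dvd_pow _ hr3).trans ?_
    rw [pow_add]
    exact (mul_dvd_mul_left _ this).mul_right _
  have := h1.add h2
  rwa [sub_add_sub_cancel] at this

/-- `f` is supported on exponents whose residue mod 11 lies in `S`. -/
def Supp (S : Finset F) (f : F⟦X⟧) : Prop := ∀ m : ℕ, (m : F) ∉ S → coeff m f = 0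

theorem Supp.mul {S T U : Finset F} {f g : F⟦X⟧} (hf : Supp S f) (hg : Supp T g)
    (h : ∀ a ∈ S, ∀ b ∈ T, a + b ∈ U) : Supp U (f * g) := by
  intro m hm
  rw [coeff_mul]
  refine sum_eq_zero fun x hx => ?_
  by_cases h1 : (x.1 : F) ∈ S
  · by_cases h2 : (x.2 : F) ∈ T
    · exfalso
      apply hm
      rw [← mem_antidiagonal.1 hx]
      push_cast
      exact h _ h1 _ h2
    · rw [hg _ h2, mul_zero]
  · rw [hf _ h1, zero_mul]

theorem Supp.add {S : Finset F} {f g : F⟦X⟧} (hf : Supp S f) (hg : Supp S g) : Supp S (f + g) := by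
  intro m hm
  rw [map_add, hf m hm, hg m hm, add_zero]

theorem Supp.mono {S T : Finset F} {f : F⟦X⟧} (hf : Supp S f) (h : S ⊆ T) : Supp T f :=
  fun m hm => hf m fun h' => hm (h h')

theorem supp_pow (f : F⟦X⟧) : Supp {0} (f ^ 11) := by
  intro m hm
  rcases m with _ | m
  · simp at hm
  have h0 : (PowerSeries.derivative F) (f ^ 11) = 0 := by
    rw [Derivation.leibniz_pow, ← Nat.cast_smul_eq_nsmul F]
    have : ((11 : ℕ) : F) = 0 := by decide
    rw [this, zero_smul]
  have h := congrArg (coeff m) h0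
  rw [coeff_derivative, map_zero] at h
  rcases mul_eq_zero.1 h with h | h
  · exact h
  · exfalso; apply hm; simp; exact_mod_cast h

theorem supp_E3 : Supp {0, 1, 3, 6, 10} (E ^ 3) := by
  intro m hm
  obtain ⟨n, hmn, hn⟩ : ∃ n : ℕ, m ≤ n ∧ (n : F) = 5 := ⟨11 * m + 5, by omega, by
    push_cast; rw [show (11 : F) = 0 by decide]; simp⟩
  have h := X_pow_dvd_iff.1 (jac_dvd n) (n.choose 2 + n * n + m) (by omega)
  rw [map_sub, map_sum, sub_eq_zero] at h
  have hz : ∀ j ∈ range (2 * n + 2), coeff (n.choose 2 + n * n + m) (((2 * n + 1 - j : ℕ) : F⟦X⟧) * (-1) ^ j * X ^ (j.choose 2 + n * (2 * n + 1 - j - 1))) = 0 := by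
    intro j hj
    have hj := mem_range.1 hj
    have e : ((2 * n + 1 - j : ℕ) : F⟦X⟧) * (-1) ^ j = C (((2 * n + 1 - j : ℕ) : F) * (-1) ^ j) := by simp
    rw [e, coeff_C_mul, coeff_X_pow]
    split_ifs with he
    · have h1 : ((2 * n + 1 - j : ℕ) : F) = - j := by
        rw [Nat.cast_sub (by omega)]; push_cast; rw [hn]
        have : (2 * 5 + 1 : F) = 0 := by decide
        rw [this, zero_sub]
      rw [h1]
      suffices (j : F) = 0 by simp [this]
      by_contra hj0
      have hjn : j ≠ 2 * n + 1 := by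
        rintro rfl
        apply hj0; push_cast; rw [hn]; decide
      have h2 : ∀ k : ℕ, 2 * ((k.choose 2 : ℕ) : F) = k * (k - 1) := by
        intro k
        have : k.choose 2 * 2 = k * (k - 1) := by
          rw [Nat.choose_two_right]; exact Nat.div_mul_cancel (Nat.even_mul_pred_self k).two_dvd
        rcases k with _ | k
        · simp
        · have := congrArg (Nat.cast : ℕ → F) this
          push_cast [Nat.add_sub_cancel] at this
          push_cast
          linear_combination this
      have h3 := congrArg (Nat.cast : ℕ → F) he
      rw [show 2 * n + 1 - j - 1 = 2 * n - j by omega] at h3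
      push_cast [Nat.cast_sub (show j ≤ 2 * n by omega)] at h3
      have h4 := h2 n
      have h5 := h2 j
      rw [hn] at h3 h4
      have h6 : 2 * (m : F) = (j : F) * (j - 1) + 10 * (10 - j) - 20 - 50 := by
        linear_combination 2 * h3 - h4 + h5
      generalize (m : F) = a at *
      generalize (j : F) = b at *
      clear h1 h2 h3 h4 h5 h
      revert a b
      decide
    · simp
  rw [sum_eq_zero hz] at h
  rw [mul_assoc, mul_comm (X ^ _), ← mul_assoc, add_comm _ m, coeff_mul_X_pow] at h
  have e : ((-1) ^ n : F⟦X⟧) = C ((-1) ^ n) := by simp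
  rw [e, coeff_C_mul] at h
  exact (mul_eq_zero.1 h).resolve_left (pow_ne_zero _ (by decide))

theorem supp_E : Supp {0, 1, 2, 4, 5, 7} E := by
  intro m hm
  apply coeff_pentagonalSeries_eq_zero
  rintro ⟨k, rfl⟩
  apply hm
  have h : 2 * ((pentagonal k : ℕ) : ℤ) = k * (3 * k - 1) := by
    exact two_mul_natCast_pentagonal k
  have h1 := congrArg (Int.cast : ℤ → F) h
  push_cast at h1
  generalize ((pentagonal k : ℕ) : F) = a at *
  generalize (k : F) = b at *
  clear hm h
  revert a b
  decide

end Ram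

namespace Ram
open PowerSeries Finset
section
variable {R : Type*} [CommRing R] (x0 x1 x2 x3 x4 : R)

/-- A monomial in the five components. -/
def mon (k a b c d e : ℕ) : R := (k : R) * (x0 ^ a * x1 ^ b * x2 ^ c * x3 ^ d * x4 ^ e)

def g0 : R := mon x0 x1 x2 x3 x4 4 0 0 1 0 3 +
  mon x0 x1 x2 x3 x4 12 0 0 2 1 1 +
  mon x0 x1 x2 x3 x4 6 0 2 0 0 2 +
  mon x0 x1 x2 x3 x4 12 0 2 1 1 0 +
  mon x0 x1 x2 x3 x4 12 1 0 0 2 1 +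
  mon x0 x1 x2 x3 x4 12 2 1 0 0 1 +
  mon x0 x1 x2 x3 x4 1 4 0 0 0 0

def g1 : R := mon x0 x1 x2 x3 x4 1 0 0 4 0 0 +
  mon x0 x1 x2 x3 x4 12 0 1 0 2 1 +
  mon x0 x1 x2 x3 x4 12 1 0 1 0 2 +
  mon x0 x1 x2 x3 x4 12 1 0 2 1 0 +
  mon x0 x1 x2 x3 x4 12 1 2 0 0 1 +
  mon x0 x1 x2 x3 x4 6 2 0 0 2 0 +
  mon x0 x1 x2 x3 x4 4 3 1 0 0 0

def g2 : R := mon x0 x1 x2 x3 x4 1 0 0 0 4 0 +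
  mon x0 x1 x2 x3 x4 12 0 1 1 0 2 +
  mon x0 x1 x2 x3 x4 12 0 1 2 1 0 +
  mon x0 x1 x2 x3 x4 4 0 3 0 0 1 +
  mon x0 x1 x2 x3 x4 12 1 1 0 2 0 +
  mon x0 x1 x2 x3 x4 12 2 0 1 0 1 +
  mon x0 x1 x2 x3 x4 6 2 2 0 0 0

def g3 : R := mon x0 x1 x2 x3 x4 4 0 0 0 1 3 +
  mon x0 x1 x2 x3 x4 12 0 0 1 2 1 +
  mon x0 x1 x2 x3 x4 6 0 2 0 2 0 +
  mon x0 x1 x2 x3 x4 24 1 1 1 0 1 +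
  mon x0 x1 x2 x3 x4 4 1 3 0 0 0 +
  mon x0 x1 x2 x3 x4 4 3 0 1 0 0

def g4 : R := mon x0 x1 x2 x3 x4 6 0 0 2 0 2 +
  mon x0 x1 x2 x3 x4 4 0 0 3 1 0 +
  mon x0 x1 x2 x3 x4 12 0 2 1 0 1 +
  mon x0 x1 x2 x3 x4 1 0 4 0 0 0 +
  mon x0 x1 x2 x3 x4 12 1 0 0 1 2 +
  mon x0 x1 x2 x3 x4 12 1 0 1 2 0 +
  mon x0 x1 x2 x3 x4 12 2 1 1 0 0

def g5 : R := mon x0 x1 x2 x3 x4 12 0 1 0 1 2 +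
  mon x0 x1 x2 x3 x4 12 0 1 1 2 0 +
  mon x0 x1 x2 x3 x4 12 1 0 2 0 1 +
  mon x0 x1 x2 x3 x4 12 1 2 1 0 0 +
  mon x0 x1 x2 x3 x4 12 2 0 0 1 1

def g6 : R := mon x0 x1 x2 x3 x4 4 0 0 0 3 1 +
  mon x0 x1 x2 x3 x4 12 0 1 2 0 1 +
  mon x0 x1 x2 x3 x4 4 0 3 1 0 0 +
  mon x0 x1 x2 x3 x4 24 1 1 0 1 1 +
  mon x0 x1 x2 x3 x4 6 2 0 2 0 0 +
  mon x0 x1 x2 x3 x4 4 3 0 0 1 0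

def g7 : R := mon x0 x1 x2 x3 x4 1 0 0 0 0 4 +
  mon x0 x1 x2 x3 x4 12 0 0 1 1 2 +
  mon x0 x1 x2 x3 x4 6 0 0 2 2 0 +
  mon x0 x1 x2 x3 x4 12 0 2 0 1 1 +
  mon x0 x1 x2 x3 x4 4 1 0 0 3 0 +
  mon x0 x1 x2 x3 x4 12 1 1 2 0 0 +
  mon x0 x1 x2 x3 x4 12 2 1 0 1 0

def g8 : R := mon x0 x1 x2 x3 x4 4 0 0 3 0 1 +
  mon x0 x1 x2 x3 x4 4 0 1 0 3 0 +
  mon x0 x1 x2 x3 x4 6 0 2 2 0 0 +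
  mon x0 x1 x2 x3 x4 4 1 0 0 0 3 +
  mon x0 x1 x2 x3 x4 24 1 0 1 1 1 +
  mon x0 x1 x2 x3 x4 12 1 2 0 1 0

def g9 : R := mon x0 x1 x2 x3 x4 4 0 1 0 0 3 +
  mon x0 x1 x2 x3 x4 24 0 1 1 1 1 +
  mon x0 x1 x2 x3 x4 4 0 3 0 1 0 +
  mon x0 x1 x2 x3 x4 4 1 0 3 0 0 +
  mon x0 x1 x2 x3 x4 6 2 0 0 0 2 +
  mon x0 x1 x2 x3 x4 12 2 0 1 1 0

def g10 : R := mon x0 x1 x2 x3 x4 6 0 0 0 2 2 +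
  mon x0 x1 x2 x3 x4 4 0 0 1 3 0 +
  mon x0 x1 x2 x3 x4 4 0 1 3 0 0 +
  mon x0 x1 x2 x3 x4 12 1 1 0 0 2 +
  mon x0 x1 x2 x3 x4 24 1 1 1 1 0 +
  mon x0 x1 x2 x3 x4 4 3 0 0 0 1

def k0 : R := mon x0 x1 x2 x3 x4 3 0 0 0 2 1 +
  mon x0 x1 x2 x3 x4 6 1 1 0 0 1 +
  mon x0 x1 x2 x3 x4 1 3 0 0 0 0

def k1 : R := mon x0 x1 x2 x3 x4 3 0 0 1 0 2 +
  mon x0 x1 x2 x3 x4 3 0 0 2 1 0 +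
  mon x0 x1 x2 x3 x4 3 0 2 0 0 1 +
  mon x0 x1 x2 x3 x4 3 1 0 0 2 0 +
  mon x0 x1 x2 x3 x4 3 2 1 0 0 0

def k2 : R := mon x0 x1 x2 x3 x4 3 0 1 0 2 0 +
  mon x0 x1 x2 x3 x4 6 1 0 1 0 1 +
  mon x0 x1 x2 x3 x4 3 1 2 0 0 0

def k3 : R := mon x0 x1 x2 x3 x4 6 0 1 1 0 1 +
  mon x0 x1 x2 x3 x4 1 0 3 0 0 0 +
  mon x0 x1 x2 x3 x4 3 2 0 1 0 0

def k4 : R := mon x0 x1 x2 x3 x4 3 0 0 0 1 2 +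
  mon x0 x1 x2 x3 x4 3 0 0 1 2 0 +
  mon x0 x1 x2 x3 x4 6 1 1 1 0 0

def k5 : R := mon x0 x1 x2 x3 x4 3 0 0 2 0 1 +
  mon x0 x1 x2 x3 x4 3 0 2 1 0 0 +
  mon x0 x1 x2 x3 x4 6 1 0 0 1 1

def k6 : R := mon x0 x1 x2 x3 x4 6 0 1 0 1 1 +
  mon x0 x1 x2 x3 x4 3 1 0 2 0 0 +
  mon x0 x1 x2 x3 x4 3 2 0 0 1 0

def k7 : R := mon x0 x1 x2 x3 x4 1 0 0 0 3 0 +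
  mon x0 x1 x2 x3 x4 3 0 1 2 0 0 +
  mon x0 x1 x2 x3 x4 6 1 1 0 1 0

def k8 : R := mon x0 x1 x2 x3 x4 1 0 0 0 0 3 +
  mon x0 x1 x2 x3 x4 6 0 0 1 1 1 +
  mon x0 x1 x2 x3 x4 3 0 2 0 1 0

def k9 : R := mon x0 x1 x2 x3 x4 1 0 0 3 0 0 +
  mon x0 x1 x2 x3 x4 3 1 0 0 0 2 +
  mon x0 x1 x2 x3 x4 6 1 0 1 1 0

def k10 : R := mon x0 x1 x2 x3 x4 3 0 1 0 0 2 +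
  mon x0 x1 x2 x3 x4 6 0 1 1 1 0 +
  mon x0 x1 x2 x3 x4 3 2 0 0 0 1

theorem sum_g : (x0 + x1 + x2 + x3 + x4) ^ 4 = g0 x0 x1 x2 x3 x4 + g1 x0 x1 x2 x3 x4 + g2 x0 x1 x2 x3 x4 + g3 x0 x1 x2 x3 x4 + g4 x0 x1 x2 x3 x4 + g5 x0 x1 x2 x3 x4 + g6 x0 x1 x2 x3 x4 + g7 x0 x1 x2 x3 x4 + g8 x0 x1 x2 x3 x4 + g9 x0 x1 x2 x3 x4 + g10 x0 x1 x2 x3 x4 := by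
  simp only [g0, g1, g2, g3, g4, g5, g6, g7, g8, g9, g10, mon]
  push_cast
  ring

theorem sum_k : (x0 + x1 + x2 + x3 + x4) ^ 3 = k0 x0 x1 x2 x3 x4 + k1 x0 x1 x2 x3 x4 + k2 x0 x1 x2 x3 x4 + k3 x0 x1 x2 x3 x4 + k4 x0 x1 x2 x3 x4 + k5 x0 x1 x2 x3 x4 + k6 x0 x1 x2 x3 x4 + k7 x0 x1 x2 x3 x4 + k8 x0 x1 x2 x3 x4 + k9 x0 x1 x2 x3 x4 + k10 x0 x1 x2 x3 x4 := by
  simp only [k0, k1, k2, k3, k4, k5, k6, k7, k8, k9, k10, mon]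
  push_cast
  ring

theorem key (h : (11 : R) = 0) (h3 : g3 x0 x1 x2 x3 x4 = 0) (h6 : g6 x0 x1 x2 x3 x4 = 0) (h8 : g8 x0 x1 x2 x3 x4 = 0) (h9 : g9 x0 x1 x2 x3 x4 = 0) (h10 : g10 x0 x1 x2 x3 x4 = 0) :
    g0 x0 x1 x2 x3 x4 * k6 x0 x1 x2 x3 x4 + g1 x0 x1 x2 x3 x4 * k5 x0 x1 x2 x3 x4 + g2 x0 x1 x2 x3 x4 * k4 x0 x1 x2 x3 x4 + g4 x0 x1 x2 x3 x4 * k2 x0 x1 x2 x3 x4 + g5 x0 x1 x2 x3 x4 * k1 x0 x1 x2 x3 x4 + g7 x0 x1 x2 x3 x4 * k10 x0 x1 x2 x3 x4 = 0 := by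
  simp only [g0, g1, g2, g3, g4, g5, g6, g7, g8, g9, g10, k0, k1, k2, k3, k4, k5, k6, k7, k8, k9, k10, mon] at *
  push_cast at *
  linear_combination ((4)*x1^1*x2^1*x4^1 + (-2)*x1^3 + (1)*x0^2*x2^1) * h3 +
    ((1)*x3^2*x4^1 + (4)*x0^1*x1^1*x4^1 + (-2)*x0^3) * h6 +
    ((-2)*x2^3 + (1)*x0^1*x4^2 + (4)*x0^1*x2^1*x3^1) * h8 +
    ((-2)*x4^3 + (4)*x2^1*x3^1*x4^1 + (1)*x1^2*x3^1) * h9 +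
    ((-2)*x3^3 + (1)*x1^1*x2^2 + (4)*x0^1*x1^1*x3^1) * h10 +
    ((1)*x3^5*x4^2 + (1)*x2^1*x3^6 + (1)*x2^6*x4^1 + (1)*x1^1*x4^6 + (14)*x1^1*x2^1*x3^1*x4^4 + (18)*x1^1*x2^2*x3^2*x4^2 + (12)*x1^1*x2^3*x3^3 + (1)*x1^2*x2^5 + (12)*x1^3*x3^1*x4^3 + (20)*x1^3*x2^1*x3^2*x4^1 + (1)*x1^5*x3^2 + (12)*x0^1*x2^3*x4^3 + (14)*x0^1*x2^4*x3^1*x4^1 + (20)*x0^1*x1^1*x3^3*x4^2 + (14)*x0^1*x1^1*x2^1*x3^4 + (18)*x0^1*x1^2*x2^2*x4^2 + (20)*x0^1*x1^2*x2^3*x3^1 + (14)*x0^1*x1^4*x2^1*x4^1 + (1)*x0^1*x1^6 + (1)*x0^2*x4^5 + (20)*x0^2*x2^1*x3^1*x4^3 + (18)*x0^2*x2^2*x3^2*x4^1 + (18)*x0^2*x1^2*x3^1*x4^2 + (18)*x0^2*x1^2*x2^1*x3^2 + (12)*x0^3*x3^3*x4^1 + (20)*x0^3*x1^1*x2^2*x4^1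 + (12)*x0^3*x1^3*x2^1 + (14)*x0^4*x1^1*x3^1*x4^1 + (1)*x0^5*x2^2 + (1)*x0^6*x3^1) * h

end

section
variable {x0 x1 x2 x3 x4 : F⟦X⟧}

theorem Supp.pow {s : F} {f : F⟦X⟧} (h : Supp {s} f) (n : ℕ) : Supp {(n : F) * s} (f ^ n) := by
  induction n with
  | zero =>
    intro m hm
    have : m ≠ 0 := by rintro rfl; simp at hm
    simp [coeff_one, this]
  | succ n ih =>
    rw [pow_succ]
    refine ih.mul h ?_
    simp
    ring

theorem Supp.mul1 {s t : F} {f g : F⟦X⟧} (hf : Supp {s} f) (hg : Supp {t} g) : Supp {s + t} (f * g) :=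
  hf.mul hg (by simp)

theorem supp_mon (h0 : Supp {0} x0) (h1 : Supp {1} x1) (h2 : Supp {3} x2) (h3 : Supp {6} x3) (h4 : Supp {10} x4)
    (k a b c d e : ℕ) (s : F) (h : (a : F) * 0 + b * 1 + c * 3 + d * 6 + e * 10 = s) :
    Supp {s} (mon x0 x1 x2 x3 x4 k a b c d e) := by
  have := ((((h0.pow a).mul1 (h1.pow b)).mul1 (h2.pow c)).mul1 (h3.pow d)).mul1 (h4.pow e)
  rw [h] at this
  intro m hm
  have e : ((k : ℕ) : F⟦X⟧) = C (k : F) := by simp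
  rw [mon, e, coeff_C_mul, this m hm, mul_zero]

theorem supp_g0 (h0 : Supp {0} x0) (h1 : Supp {1} x1) (h2 : Supp {3} x2) (h3 : Supp {6} x3) (h4 : Supp {10} x4) : Supp {0} (g0 x0 x1 x2 x3 x4) := by
  unfold g0
  repeat' apply Supp.add
  all_goals exact supp_mon h0 h1 h2 h3 h4 _ _ _ _ _ _ _ (by decide)

theorem supp_g1 (h0 : Supp {0} x0) (h1 : Supp {1} x1) (h2 : Supp {3} x2) (h3 : Supp {6} x3) (h4 : Supp {10} x4) : Supp {1} (g1 x0 x1 x2 x3 x4) := by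
  unfold g1
  repeat' apply Supp.add
  all_goals exact supp_mon h0 h1 h2 h3 h4 _ _ _ _ _ _ _ (by decide)

theorem supp_g2 (h0 : Supp {0} x0) (h1 : Supp {1} x1) (h2 : Supp {3} x2) (h3 : Supp {6} x3) (h4 : Supp {10} x4) : Supp {2} (g2 x0 x1 x2 x3 x4) := by
  unfold g2
  repeat' apply Supp.add
  all_goals exact supp_mon h0 h1 h2 h3 h4 _ _ _ _ _ _ _ (by decide)

theorem supp_g3 (h0 : Supp {0} x0) (h1 : Supp {1} x1) (h2 : Supp {3} x2) (h3 : Supp {6} x3) (h4 : Supp {10} x4) : Supp {3} (g3 x0 x1 x2 x3 x4) := by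
  unfold g3
  repeat' apply Supp.add
  all_goals exact supp_mon h0 h1 h2 h3 h4 _ _ _ _ _ _ _ (by decide)

theorem supp_g4 (h0 : Supp {0} x0) (h1 : Supp {1} x1) (h2 : Supp {3} x2) (h3 : Supp {6} x3) (h4 : Supp {10} x4) : Supp {4} (g4 x0 x1 x2 x3 x4) := by
  unfold g4
  repeat' apply Supp.add
  all_goals exact supp_mon h0 h1 h2 h3 h4 _ _ _ _ _ _ _ (by decide)

theorem supp_g5 (h0 : Supp {0} x0) (h1 : Supp {1} x1) (h2 : Supp {3} x2) (h3 : Supp {6} x3) (h4 : Supp {10} x4) : Supp {5} (g5 x0 x1 x2 x3 x4) := by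
  unfold g5
  repeat' apply Supp.add
  all_goals exact supp_mon h0 h1 h2 h3 h4 _ _ _ _ _ _ _ (by decide)

theorem supp_g6 (h0 : Supp {0} x0) (h1 : Supp {1} x1) (h2 : Supp {3} x2) (h3 : Supp {6} x3) (h4 : Supp {10} x4) : Supp {6} (g6 x0 x1 x2 x3 x4) := by
  unfold g6
  repeat' apply Supp.add
  all_goals exact supp_mon h0 h1 h2 h3 h4 _ _ _ _ _ _ _ (by decide)

theorem supp_g7 (h0 : Supp {0} x0) (h1 : Supp {1} x1) (h2 : Supp {3} x2) (h3 : Supp {6} x3) (h4 : Supp {10} x4) : Supp {7} (g7 x0 x1 x2 x3 x4) := by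
  unfold g7
  repeat' apply Supp.add
  all_goals exact supp_mon h0 h1 h2 h3 h4 _ _ _ _ _ _ _ (by decide)

theorem supp_g8 (h0 : Supp {0} x0) (h1 : Supp {1} x1) (h2 : Supp {3} x2) (h3 : Supp {6} x3) (h4 : Supp {10} x4) : Supp {8} (g8 x0 x1 x2 x3 x4) := by
  unfold g8
  repeat' apply Supp.add
  all_goals exact supp_mon h0 h1 h2 h3 h4 _ _ _ _ _ _ _ (by decide)

theorem supp_g9 (h0 : Supp {0} x0) (h1 : Supp {1} x1) (h2 : Supp {3} x2) (h3 : Supp {6} x3) (h4 : Supp {10} x4) : Supp {9} (g9 x0 x1 x2 x3 x4) := by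
  unfold g9
  repeat' apply Supp.add
  all_goals exact supp_mon h0 h1 h2 h3 h4 _ _ _ _ _ _ _ (by decide)

theorem supp_g10 (h0 : Supp {0} x0) (h1 : Supp {1} x1) (h2 : Supp {3} x2) (h3 : Supp {6} x3) (h4 : Supp {10} x4) : Supp {10} (g10 x0 x1 x2 x3 x4) := by
  unfold g10
  repeat' apply Supp.add
  all_goals exact supp_mon h0 h1 h2 h3 h4 _ _ _ _ _ _ _ (by decide)

theorem supp_k0 (h0 : Supp {0} x0) (h1 : Supp {1} x1) (h2 : Supp {3} x2) (h3 : Supp {6} x3) (h4 : Supp {10} x4) : Supp {0} (k0 x0 x1 x2 x3 x4) := by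
  unfold k0
  repeat' apply Supp.add
  all_goals exact supp_mon h0 h1 h2 h3 h4 _ _ _ _ _ _ _ (by decide)

theorem supp_k1 (h0 : Supp {0} x0) (h1 : Supp {1} x1) (h2 : Supp {3} x2) (h3 : Supp {6} x3) (h4 : Supp {10} x4) : Supp {1} (k1 x0 x1 x2 x3 x4) := by
  unfold k1
  repeat' apply Supp.add
  all_goals exact supp_mon h0 h1 h2 h3 h4 _ _ _ _ _ _ _ (by decide)

theorem supp_k2 (h0 : Supp {0} x0) (h1 : Supp {1} x1) (h2 : Supp {3} x2) (h3 : Supp {6} x3) (h4 : Supp {10} x4) : Supp {2} (k2 x0 x1 x2 x3 x4) := by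
  unfold k2
  repeat' apply Supp.add
  all_goals exact supp_mon h0 h1 h2 h3 h4 _ _ _ _ _ _ _ (by decide)

theorem supp_k3 (h0 : Supp {0} x0) (h1 : Supp {1} x1) (h2 : Supp {3} x2) (h3 : Supp {6} x3) (h4 : Supp {10} x4) : Supp {3} (k3 x0 x1 x2 x3 x4) := by
  unfold k3
  repeat' apply Supp.add
  all_goals exact supp_mon h0 h1 h2 h3 h4 _ _ _ _ _ _ _ (by decide)

theorem supp_k4 (h0 : Supp {0} x0) (h1 : Supp {1} x1) (h2 : Supp {3} x2) (h3 : Supp {6} x3) (h4 : Supp {10} x4) : Supp {4} (k4 x0 x1 x2 x3 x4) := by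
  unfold k4
  repeat' apply Supp.add
  all_goals exact supp_mon h0 h1 h2 h3 h4 _ _ _ _ _ _ _ (by decide)

theorem supp_k5 (h0 : Supp {0} x0) (h1 : Supp {1} x1) (h2 : Supp {3} x2) (h3 : Supp {6} x3) (h4 : Supp {10} x4) : Supp {5} (k5 x0 x1 x2 x3 x4) := by
  unfold k5
  repeat' apply Supp.add
  all_goals exact supp_mon h0 h1 h2 h3 h4 _ _ _ _ _ _ _ (by decide)

theorem supp_k6 (h0 : Supp {0} x0) (h1 : Supp {1} x1) (h2 : Supp {3} x2) (h3 : Supp {6} x3) (h4 : Supp {10} x4) : Supp {6} (k6 x0 x1 x2 x3 x4) := by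
  unfold k6
  repeat' apply Supp.add
  all_goals exact supp_mon h0 h1 h2 h3 h4 _ _ _ _ _ _ _ (by decide)

theorem supp_k7 (h0 : Supp {0} x0) (h1 : Supp {1} x1) (h2 : Supp {3} x2) (h3 : Supp {6} x3) (h4 : Supp {10} x4) : Supp {7} (k7 x0 x1 x2 x3 x4) := by
  unfold k7
  repeat' apply Supp.add
  all_goals exact supp_mon h0 h1 h2 h3 h4 _ _ _ _ _ _ _ (by decide)

theorem supp_k8 (h0 : Supp {0} x0) (h1 : Supp {1} x1) (h2 : Supp {3} x2) (h3 : Supp {6} x3) (h4 : Supp {10} x4) : Supp {8} (k8 x0 x1 x2 x3 x4) := by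
  unfold k8
  repeat' apply Supp.add
  all_goals exact supp_mon h0 h1 h2 h3 h4 _ _ _ _ _ _ _ (by decide)

theorem supp_k9 (h0 : Supp {0} x0) (h1 : Supp {1} x1) (h2 : Supp {3} x2) (h3 : Supp {6} x3) (h4 : Supp {10} x4) : Supp {9} (k9 x0 x1 x2 x3 x4) := by
  unfold k9
  repeat' apply Supp.add
  all_goals exact supp_mon h0 h1 h2 h3 h4 _ _ _ _ _ _ _ (by decide)

theorem supp_k10 (h0 : Supp {0} x0) (h1 : Supp {1} x1) (h2 : Supp {3} x2) (h3 : Supp {6} x3) (h4 : Supp {10} x4) : Supp {10} (k10 x0 x1 x2 x3 x4) := by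
  unfold k10
  repeat' apply Supp.add
  all_goals exact supp_mon h0 h1 h2 h3 h4 _ _ _ _ _ _ _ (by decide)

theorem main_alg (h0 : Supp {0} x0) (h1 : Supp {1} x1) (h2 : Supp {3} x2) (h3 : Supp {6} x3) (h4 : Supp {10} x4)
    (hq : Supp {0, 1, 2, 4, 5, 7} ((x0 + x1 + x2 + x3 + x4) ^ 4)) :
    Supp ({6}ᶜ) ((x0 + x1 + x2 + x3 + x4) ^ 7) := by
  rw [sum_g] at hq
  have a0 := supp_g0 h0 h1 h2 h3 h4
  have b0 := supp_k0 h0 h1 h2 h3 h4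
  have a1 := supp_g1 h0 h1 h2 h3 h4
  have b1 := supp_k1 h0 h1 h2 h3 h4
  have a2 := supp_g2 h0 h1 h2 h3 h4
  have b2 := supp_k2 h0 h1 h2 h3 h4
  have a3 := supp_g3 h0 h1 h2 h3 h4
  have b3 := supp_k3 h0 h1 h2 h3 h4
  have a4 := supp_g4 h0 h1 h2 h3 h4
  have b4 := supp_k4 h0 h1 h2 h3 h4
  have a5 := supp_g5 h0 h1 h2 h3 h4
  have b5 := supp_k5 h0 h1 h2 h3 h4
  have a6 := supp_g6 h0 h1 h2 h3 h4
  have b6 := supp_k6 h0 h1 h2 h3 h4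
  have a7 := supp_g7 h0 h1 h2 h3 h4
  have b7 := supp_k7 h0 h1 h2 h3 h4
  have a8 := supp_g8 h0 h1 h2 h3 h4
  have b8 := supp_k8 h0 h1 h2 h3 h4
  have a9 := supp_g9 h0 h1 h2 h3 h4
  have b9 := supp_k9 h0 h1 h2 h3 h4
  have a10 := supp_g10 h0 h1 h2 h3 h4
  have b10 := supp_k10 h0 h1 h2 h3 h4
  have z3 : g3 x0 x1 x2 x3 x4 = 0 := by
    ext m
    rw [map_zero]
    by_cases hm : (m : F) = 3
    · have := hq m (by rw [hm]; decide)
      simp only [map_add] at this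
      rw [a0 m (by rw [hm]; decide), a1 m (by rw [hm]; decide), a2 m (by rw [hm]; decide), a4 m (by rw [hm]; decide), a5 m (by rw [hm]; decide), a6 m (by rw [hm]; decide), a7 m (by rw [hm]; decide), a8 m (by rw [hm]; decide), a9 m (by rw [hm]; decide), a10 m (by rw [hm]; decide)] at this
      simpa using this
    · exact a3 m (by simpa using hm)
  have z6 : g6 x0 x1 x2 x3 x4 = 0 := by
    ext m
    rw [map_zero]
    by_cases hm : (m : F) = 6
    · have := hq m (by rw [hm]; decide)
      simp only [map_add] at this
      rw [a0 m (by rw [hm]; decide), a1 m (by rw [hm]; decide), a2 m (by rw [hm]; decide), a3 m (by rw [hm]; decide), a4 m (by rw [hm]; decide), a5 m (by rw [hm]; decide), a7 m (by rw [hm]; decide), a8 m (by rw [hm]; decide), a9 m (by rw [hm]; decide), a10 m (by rw [hm]; decide)] at this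
      simpa using this
    · exact a6 m (by simpa using hm)
  have z8 : g8 x0 x1 x2 x3 x4 = 0 := by
    ext m
    rw [map_zero]
    by_cases hm : (m : F) = 8
    · have := hq m (by rw [hm]; decide)
      simp only [map_add] at this
      rw [a0 m (by rw [hm]; decide), a1 m (by rw [hm]; decide), a2 m (by rw [hm]; decide), a3 m (by rw [hm]; decide), a4 m (by rw [hm]; decide), a5 m (by rw [hm]; decide), a6 m (by rw [hm]; decide), a7 m (by rw [hm]; decide), a9 m (by rw [hm]; decide), a10 m (by rw [hm]; decide)] at this
      simpa using this
    · exact a8 m (by simpa using hm)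
  have z9 : g9 x0 x1 x2 x3 x4 = 0 := by
    ext m
    rw [map_zero]
    by_cases hm : (m : F) = 9
    · have := hq m (by rw [hm]; decide)
      simp only [map_add] at this
      rw [a0 m (by rw [hm]; decide), a1 m (by rw [hm]; decide), a2 m (by rw [hm]; decide), a3 m (by rw [hm]; decide), a4 m (by rw [hm]; decide), a5 m (by rw [hm]; decide), a6 m (by rw [hm]; decide), a7 m (by rw [hm]; decide), a8 m (by rw [hm]; decide), a10 m (by rw [hm]; decide)] at this
      simpa using this
    · exact a9 m (by simpa using hm)
  have z10 : g10 x0 x1 x2 x3 x4 = 0 := by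
    ext m
    rw [map_zero]
    by_cases hm : (m : F) = 10
    · have := hq m (by rw [hm]; decide)
      simp only [map_add] at this
      rw [a0 m (by rw [hm]; decide), a1 m (by rw [hm]; decide), a2 m (by rw [hm]; decide), a3 m (by rw [hm]; decide), a4 m (by rw [hm]; decide), a5 m (by rw [hm]; decide), a6 m (by rw [hm]; decide), a7 m (by rw [hm]; decide), a8 m (by rw [hm]; decide), a9 m (by rw [hm]; decide)] at this
      simpa using this
    · exact a10 m (by simpa using hm)
  have h11 : (11 : F⟦X⟧) = 0 := by
    have h : ((11 : ℕ) : F⟦X⟧) = C ((11 : ℕ) : F) := (map_natCast C 11).symm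
    rw [show ((11 : ℕ) : F) = 0 by decide, map_zero] at h
    exact_mod_cast h
  have hk := key x0 x1 x2 x3 x4 h11 z3 z6 z8 z9 z10
  have e : (x0 + x1 + x2 + x3 + x4) ^ 7 = g0 x0 x1 x2 x3 x4 * (k0 x0 x1 x2 x3 x4 + k1 x0 x1 x2 x3 x4 + k2 x0 x1 x2 x3 x4 + k3 x0 x1 x2 x3 x4 + k4 x0 x1 x2 x3 x4 + k5 x0 x1 x2 x3 x4 + k7 x0 x1 x2 x3 x4 + k8 x0 x1 x2 x3 x4 + k9 x0 x1 x2 x3 x4 + k10 x0 x1 x2 x3 x4) +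
    g1 x0 x1 x2 x3 x4 * (k0 x0 x1 x2 x3 x4 + k1 x0 x1 x2 x3 x4 + k2 x0 x1 x2 x3 x4 + k3 x0 x1 x2 x3 x4 + k4 x0 x1 x2 x3 x4 + k6 x0 x1 x2 x3 x4 + k7 x0 x1 x2 x3 x4 + k8 x0 x1 x2 x3 x4 + k9 x0 x1 x2 x3 x4 + k10 x0 x1 x2 x3 x4) +
    g2 x0 x1 x2 x3 x4 * (k0 x0 x1 x2 x3 x4 + k1 x0 x1 x2 x3 x4 + k2 x0 x1 x2 x3 x4 + k3 x0 x1 x2 x3 x4 + k5 x0 x1 x2 x3 x4 + k6 x0 x1 x2 x3 x4 + k7 x0 x1 x2 x3 x4 + k8 x0 x1 x2 x3 x4 + k9 x0 x1 x2 x3 x4 + k10 x0 x1 x2 x3 x4) +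
    g4 x0 x1 x2 x3 x4 * (k0 x0 x1 x2 x3 x4 + k1 x0 x1 x2 x3 x4 + k3 x0 x1 x2 x3 x4 + k4 x0 x1 x2 x3 x4 + k5 x0 x1 x2 x3 x4 + k6 x0 x1 x2 x3 x4 + k7 x0 x1 x2 x3 x4 + k8 x0 x1 x2 x3 x4 + k9 x0 x1 x2 x3 x4 + k10 x0 x1 x2 x3 x4) +
    g5 x0 x1 x2 x3 x4 * (k0 x0 x1 x2 x3 x4 + k2 x0 x1 x2 x3 x4 + k3 x0 x1 x2 x3 x4 + k4 x0 x1 x2 x3 x4 + k5 x0 x1 x2 x3 x4 + k6 x0 x1 x2 x3 x4 + k7 x0 x1 x2 x3 x4 + k8 x0 x1 x2 x3 x4 + k9 x0 x1 x2 x3 x4 + k10 x0 x1 x2 x3 x4) +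
    g7 x0 x1 x2 x3 x4 * (k0 x0 x1 x2 x3 x4 + k1 x0 x1 x2 x3 x4 + k2 x0 x1 x2 x3 x4 + k3 x0 x1 x2 x3 x4 + k4 x0 x1 x2 x3 x4 + k5 x0 x1 x2 x3 x4 + k6 x0 x1 x2 x3 x4 + k7 x0 x1 x2 x3 x4 + k8 x0 x1 x2 x3 x4 + k9 x0 x1 x2 x3 x4) := by
    rw [show (7 : ℕ) = 4 + 3 by norm_num, pow_add, sum_g, sum_k, z3, z6, z8, z9, z10]
    linear_combination hk
  rw [e]
  refine Supp.add (Supp.add (Supp.add (Supp.add (Supp.add ?_ ?_) ?_) ?_) ?_) ?_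
  · exact a0.mul (T := {6}ᶜ) (Supp.add (Supp.add (Supp.add (Supp.add (Supp.add (Supp.add (Supp.add (Supp.add (Supp.add (b0.mono (by decide)) (b1.mono (by decide))) (b2.mono (by decide))) (b3.mono (by decide))) (b4.mono (by decide))) (b5.mono (by decide))) (b7.mono (by decide))) (b8.mono (by decide))) (b9.mono (by decide))) (b10.mono (by decide))) (by decide)
  · exact a1.mul (T := {5}ᶜ) (Supp.add (Supp.add (Supp.add (Supp.add (Supp.add (Supp.add (Supp.add (Supp.add (Supp.add (b0.mono (by decide)) (b1.mono (by decide))) (b2.mono (by decide))) (b3.mono (by decide))) (b4.mono (by decide))) (b6.mono (by decide))) (b7.mono (by decide))) (b8.mono (by decide))) (b9.mono (by decide))) (b10.mono (by decide))) (by decide)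
  · exact a2.mul (T := {4}ᶜ) (Supp.add (Supp.add (Supp.add (Supp.add (Supp.add (Supp.add (Supp.add (Supp.add (Supp.add (b0.mono (by decide)) (b1.mono (by decide))) (b2.mono (by decide))) (b3.mono (by decide))) (b5.mono (by decide))) (b6.mono (by decide))) (b7.mono (by decide))) (b8.mono (by decide))) (b9.mono (by decide))) (b10.mono (by decide))) (by decide)
  · exact a4.mul (T := {2}ᶜ) (Supp.add (Supp.add (Supp.add (Supp.add (Supp.add (Supp.add (Supp.add (Supp.add (Supp.add (b0.mono (by decide)) (b1.mono (by decide))) (b3.mono (by decide))) (b4.mono (by decide))) (b5.mono (by decide))) (b6.mono (by decide))) (b7.mono (by decide))) (b8.mono (by decide))) (b9.mono (by decide))) (b10.mono (by decide))) (by decide)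
  · exact a5.mul (T := {1}ᶜ) (Supp.add (Supp.add (Supp.add (Supp.add (Supp.add (Supp.add (Supp.add (Supp.add (Supp.add (b0.mono (by decide)) (b2.mono (by decide))) (b3.mono (by decide))) (b4.mono (by decide))) (b5.mono (by decide))) (b6.mono (by decide))) (b7.mono (by decide))) (b8.mono (by decide))) (b9.mono (by decide))) (b10.mono (by decide))) (by decide)
  · exact a7.mul (T := {10}ᶜ) (Supp.add (Supp.add (Supp.add (Supp.add (Supp.add (Supp.add (Supp.add (Supp.add (Supp.add (b0.mono (by decide)) (b1.mono (by decide))) (b2.mono (by decide))) (b3.mono (by decide))) (b4.mono (by decide))) (b5.mono (by decide))) (b6.mono (by decide))) (b7.mono (by decide))) (b8.mono (by decide))) (b9.mono (by decide))) (by decide)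
end

noncomputable def pr (c : F) (f : F⟦X⟧) : F⟦X⟧ := PowerSeries.mk fun m => if (m : F) = c then coeff m f else 0

theorem supp_pr (c : F) (f : F⟦X⟧) : Supp {c} (pr c f) := by
  intro m hm
  have : ¬ (m : F) = c := by simpa using hm
  simp [pr, this]

theorem decomp : E ^ 3 = pr 0 (E ^ 3) + pr 1 (E ^ 3) + pr 3 (E ^ 3) + pr 6 (E ^ 3) + pr 10 (E ^ 3) := by
  ext m
  have h := supp_E3 m
  generalize E ^ 3 = f at *
  simp only [pr, map_add, coeff_mk]
  generalize (m : F) = a at *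
  generalize coeff m f = b at *
  revert a b
  decide

theorem ramanujan (n : ℕ) : (P (11 * n + 6) : F) = 0 := by
  have h7 : Supp ({6}ᶜ) ((E ^ 3) ^ 7) := by
    have h4 : Supp {0, 1, 2, 4, 5, 7} ((E ^ 3) ^ 4) := by
      rw [show (E ^ 3) ^ 4 = E * E ^ 11 by ring]
      exact supp_E.mul (supp_pow E) (by decide)
    rw [decomp] at h4 ⊢
    exact main_alg (supp_pr _ _) (supp_pr _ _) (supp_pr _ _) (supp_pr _ _) (supp_pr _ _) h4
  have hP : PG = (E ^ 3) ^ 7 * (PG ^ 2) ^ 11 := by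
    calc PG = (PG * E) ^ 21 * PG := by rw [PG_mul_E]; ring
      _ = _ := by ring
  have h : Supp ({6}ᶜ) PG := by
    rw [hP]
    exact h7.mul (supp_pow _) (by decide)
  have := h (11 * n + 6) (by
    push_cast; rw [show (11 : F) = 0 by decide]; simp)
  simpa [PG] using this

theorem Q_rec (k n : ℕ) (hk : 0 < k) : Q k (n + k) = Q k n + P n := by
  classical
  have h1 : Q k (n + k) = ∑ p : Nat.Partition (n + k) with k ∈ p.parts, Multiset.count k p.parts := by
    rw [Q, sum_filter]
    refine sum_congr rfl fun p _ => ?_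
    split_ifs with h
    · rfl
    · exact Multiset.count_eq_zero.2 h
  have h2 : Q k n + P n = ∑ p : Nat.Partition n, (Multiset.count k p.parts + 1) := by
    rw [sum_add_distrib, Q, P]
    simp
  rw [h1, h2]
  symm
  refine sum_bij' (fun p _ => (⟨k ::ₘ p.parts, by
      intro i hi
      rcases Multiset.mem_cons.1 hi with rfl | hi
      · exact hk
      · exact p.parts_pos hi, by rw [Multiset.sum_cons, p.parts_sum, add_comm]⟩ : Nat.Partition (n + k)))
    (fun p hp => (⟨p.parts.erase k, fun {i} hi => p.parts_pos (Multiset.mem_of_mem_erase hi), by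
      have h := Multiset.sum_erase (mem_filter.1 hp).2
      rw [p.parts_sum] at h
      omega⟩ : Nat.Partition n)) ?_ ?_ ?_ ?_ ?_
  · intro p _; simp
  · intro p _; simp
  · intro p _; ext1; simp
  · intro p hp; ext1; exact Multiset.cons_erase (mem_filter.1 hp).2
  · intro p _; simp

theorem Q_base : Q 11 6 = 0 := by
  rw [Q]
  refine sum_eq_zero fun p _ => Multiset.count_eq_zero.2 fun h => ?_
  have := Multiset.le_sum_of_mem h
  rw [p.parts_sum] at this
  omega

end Ram

theorem stmt_9 (n : ℕ) : Q 11 (11 * n + 6) ≡ 0 [MOD 11] := by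
  rw [← ZMod.natCast_eq_natCast_iff]
  induction n with
  | zero => simp [Ram.Q_base]
  | succ n ih =>
    rw [show 11 * (n + 1) + 6 = 11 * n + 6 + 11 by ring, Ram.Q_rec _ _ (by norm_num)]
    push_cast at ih ⊢
    rw [ih]
    simpa using Ram.ramanujan n
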